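/- Fix an integer l ≥ 1. There exists a constant C > 0, depending only on l, such that for every integer k ≥ 2 and all real numbers b_i ∈ [−1,1] (2 ≤ i ≤ k) and b_{ij} ∈ [−1,1] (2 ≤ i < j ≤ k, with b_{ji} := b_{ij}), one has |l!·S_{1,l} − β·M^l + l·T₁·M^{l−1} + l·(l−1)·β·T₂·M^{l−2}| ≤ C·k^{2l−1}, where for l = 1 the term l·(l−1)·β·T₂·M^{l−2} is taken to be 0. -/

import Mathlib

namespace S17
open Finset

abbrev Pos (l : ℕ) := Option (Fin l × Bool)

def Bad {P ι : Type*} (f : P → ι) : Prop :=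
  ∃ r t r' t' : P, r ≠ t ∧ (r' ≠ r ∧ r' ≠ t) ∧ (t' ≠ r ∧ t' ≠ t) ∧ f r = f r' ∧ f t = f t'

lemma bad_of {P ι : Type*} (f : P → ι) {p q p' q' : P} (h : p ≠ q) (h' : p' ≠ q')
    (e : f p = f q) (e' : f p' = f q') (h1 : ¬ (p' = p ∧ q' = q)) (h2 : ¬ (p' = q ∧ q' = p)) :
    Bad f := by
  by_cases a : p' ≠ p ∧ p' ≠ q
  · by_cases c : q' = p
    · exact ⟨p', q, q', p, by grind, by grind, by grind, by grind, by grind⟩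
    · exact ⟨p', p, q', q, by grind, by grind, by grind, by grind, by grind⟩
  · by_cases c : p' = p
    · exact ⟨q', q, p', p, by grind, by grind, by grind, by grind, by grind⟩
    · exact ⟨q', p, p', q, by grind, by grind, by grind, by grind, by grind⟩

open Classical in
lemma card_fixed {P ι : Type*} [Fintype P] [Fintype ι] (r t r' t' : P) (hrt : r ≠ t)
    (hr : r' ≠ r ∧ r' ≠ t) (ht : t' ≠ r ∧ t' ≠ t) :
    (univ.filter (fun f : P → ι => f r = f r' ∧ f t = f t')).card ≤
      Fintype.card ι ^ (Fintype.card P - 2) := by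
  have hc : Fintype.card {x : P // x ∈ ((univ : Finset P).erase r).erase t}
      = Fintype.card P - 2 := by
    rw [Fintype.card_coe, card_erase_of_mem (by simp [hrt.symm]), card_erase_of_mem (by simp),
      card_univ]
    omega
  rw [← hc, ← Fintype.card_fun, ← card_univ]
  apply card_le_card_of_injOn (fun f x => f x.1) (by simp)
  intro f hf g hg h
  simp only [coe_filter, mem_univ, true_and, Set.mem_ofPred_eq] at hf hg
  have key : ∀ x, x ≠ r → x ≠ t → f x = g x := by
    intro x h1 h2
    exact congrFun h ⟨x, by simp [h1, h2]⟩
  funext x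
  by_cases h1 : x = r
  · rw [h1, hf.1, hg.1]; exact key _ hr.1 hr.2
  by_cases h2 : x = t
  · rw [h2, hf.2, hg.2]; exact key _ ht.1 ht.2
  exact key x h1 h2

open Classical in
lemma card_bad (P ι : Type*) [Fintype P] [Fintype ι] :
    (univ.filter (fun f : P → ι => Bad f)).card ≤
      Fintype.card P ^ 4 * Fintype.card ι ^ (Fintype.card P - 2) := by
  have hsub : univ.filter (fun f : P → ι => Bad f) ⊆
      (univ.filter (fun w : P × P × P × P => w.1 ≠ w.2.1 ∧ (w.2.2.1 ≠ w.1 ∧ w.2.2.1 ≠ w.2.1) ∧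
        (w.2.2.2 ≠ w.1 ∧ w.2.2.2 ≠ w.2.1))).biUnion
      (fun w => univ.filter (fun f : P → ι => f w.1 = f w.2.2.1 ∧ f w.2.1 = f w.2.2.2)) := by
    intro f hf
    simp only [mem_filter, mem_univ, true_and] at hf
    obtain ⟨r, t, r', t', h1, h2, h3, h4⟩ := hf
    simp only [mem_biUnion, mem_filter, mem_univ, true_and]
    exact ⟨(r, t, r', t'), ⟨h1, h2, h3⟩, h4⟩
  refine (card_le_card hsub).trans ((card_biUnion_le_card_mul _ _
    (Fintype.card ι ^ (Fintype.card P - 2)) ?_).trans ?_)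
  · intro w hw
    simp only [mem_filter, mem_univ, true_and] at hw
    exact card_fixed _ _ _ _ hw.1 hw.2.1 hw.2.2
  · apply Nat.mul_le_mul_right
    refine (card_le_univ _).trans (le_of_eq ?_)
    simp only [Fintype.card_prod]; ring

open Classical in
/-- coincidence counting -/
lemma coinc {P ι : Type*} [Fintype P] (f : P → ι) :
    |(∑ p : P, ∑ q : P, if p ≠ q ∧ f p = f q then (1 : ℝ) else 0) -
      2 * (1 - if Function.Injective f then 1 else 0)| ≤
    ((Fintype.card P : ℝ) ^ 2 + 2) * (if Bad f then 1 else 0) := by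
  by_cases hb : Bad f
  · have h0 : 0 ≤ ∑ p : P, ∑ q : P, if p ≠ q ∧ f p = f q then (1 : ℝ) else 0 :=
      sum_nonneg fun p _ => sum_nonneg fun q _ => by split_ifs <;> norm_num
    have h1 : (∑ p : P, ∑ q : P, if p ≠ q ∧ f p = f q then (1 : ℝ) else 0) ≤
        (Fintype.card P : ℝ) ^ 2 := by
      calc _ ≤ ∑ p : P, ∑ q : P, (1 : ℝ) :=
            sum_le_sum fun p _ => sum_le_sum fun q _ => by split_ifs <;> norm_num
        _ = _ := by simp [pow_two]
    rw [if_pos hb, abs_le]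
    split_ifs <;> constructor <;> nlinarith
  · rw [if_neg hb, mul_zero]
    apply le_of_eq
    rw [abs_eq_zero]
    by_cases hi : Function.Injective f
    · rw [if_pos hi]
      have : ∀ p q, ¬ (p ≠ q ∧ f p = f q) := fun p q h => h.1 (hi h.2)
      simp only [this, if_false]; simp
    · rw [if_neg hi]
      obtain ⟨p, q, e, h⟩ : ∃ p q, f p = f q ∧ p ≠ q := by
        simpa [Function.Injective] using hi
      have hs : (∑ p : P, ∑ q : P, if p ≠ q ∧ f p = f q then (1 : ℝ) else 0) =
          ∑ w : P × P, ((if w = (p, q) then 1 else 0) + if w = (q, p) then (1 : ℝ) else 0) := by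
        rw [Fintype.sum_prod_type]
        refine sum_congr rfl fun x _ => sum_congr rfl fun y _ => ?_
        by_cases hxy : x ≠ y ∧ f x = f y
        · rw [if_pos hxy]
          have := fun h1 h2 => hb (bad_of f h hxy.1 e hxy.2 h1 h2)
          simp only [Prod.mk.injEq]
          grind
        · rw [if_neg hxy]
          simp only [Prod.mk.injEq]
          grind
      rw [hs, sum_add_distrib]
      simp; norm_num

/-- main coincidence estimate -/
lemma main_est {P ι : Type*} [Fintype P] [Fintype ι] [DecidableEq P] [DecidableEq ι]
    (F : (P → ι) → ℝ) (hF : ∀ f, |F f| ≤ 1) [DecidablePred (Function.Injective : (P → ι) → Prop)] :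
    |(∑ p : P, ∑ q : P, if p ≠ q then ∑ f : P → ι, F f * (if f p = f q then 1 else 0) else 0) -
      2 * (∑ f, F f - ∑ f with Function.Injective f, F f)| ≤
    ((Fintype.card P : ℝ) ^ 2 + 2) *
      (Fintype.card P ^ 4 * Fintype.card ι ^ (Fintype.card P - 2)) := by
  classical
  have e : (∑ p : P, ∑ q : P, if p ≠ q then ∑ f : P → ι, F f * (if f p = f q then 1 else 0) else 0) -
      2 * (∑ f, F f - ∑ f with Function.Injective f, F f) =
      ∑ f : P → ι, F f * ((∑ p : P, ∑ q : P, if p ≠ q ∧ f p = f q then (1 : ℝ) else 0) -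
      2 * (1 - if Function.Injective f then 1 else 0)) := by
    simp only [mul_sub, sum_sub_distrib, mul_sum]
    congr 1
    · symm
      rw [sum_comm]
      refine sum_congr rfl fun p _ => ?_
      rw [sum_comm]
      refine sum_congr rfl fun q _ => ?_
      by_cases h : p = q <;> simp [h]
    · rw [sum_filter]
      congr 1
      · refine sum_congr rfl fun p _ => by ring
      · refine sum_congr rfl fun p _ => ?_
        split_ifs <;> ring
  rw [e]
  refine (abs_sum_le_sum_abs _ _).trans ?_
  calc _ ≤ ∑ f : P → ι, ((Fintype.card P : ℝ) ^ 2 + 2) * (if Bad f then 1 else 0) := by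
        refine sum_le_sum fun f _ => ?_
        rw [abs_mul]
        have h1 := coinc f
        have h2 := hF f
        calc _ ≤ 1 * _ := mul_le_mul_of_nonneg_right h2 (abs_nonneg _)
          _ ≤ _ := by rw [one_mul]; convert h1
    _ = ((Fintype.card P : ℝ) ^ 2 + 2) * (univ.filter (fun f : P → ι => Bad f)).card := by
        rw [← mul_sum]; simp
    _ ≤ _ := by
        apply mul_le_mul_of_nonneg_left _ (by positivity)
        have h := card_bad P ι
        have h' : (univ.filter (fun f : P → ι => Bad f)).card ≤
          Fintype.card P ^ 4 * Fintype.card ι ^ (Fintype.card P - 2) := by convert h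
        exact_mod_cast h'

lemma factor {ι : Type*} [Fintype ι] [DecidableEq ι] (l : ℕ) (u : ι → ℝ)
    (v : Fin l → ι → ι → ℝ) :
    ∑ f : Pos l → ι, u (f none) * ∏ m, v m (f (some (m, false))) (f (some (m, true))) =
      (∑ x, u x) * ∏ m, ∑ x, ∑ y, v m x y := by
  have h1 : ∏ m, ∑ x, ∑ y, v m x y = ∑ e : Fin l → ι × ι, ∏ m, v m (e m).1 (e m).2 := by
    have := Finset.prod_univ_sum (fun _ : Fin l => (univ : Finset (ι × ι)))
      (fun m w => v m w.1 w.2)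
    simpa [Fintype.sum_prod_type] using this
  rw [h1, sum_mul_sum, ← Fintype.sum_prod_type'
    (f := fun (x : ι) (e : Fin l → ι × ι) => u x * ∏ m, v m (e m).1 (e m).2)]
  let E : (Pos l → ι) ≃ ι × (Fin l → ι × ι) :=
    { toFun := fun f => (f none, fun m => (f (some (m, false)), f (some (m, true))))
      invFun := fun w p => match p with
        | none => w.1
        | some (m, false) => (w.2 m).1
        | some (m, true) => (w.2 m).2
      left_inv := by
        intro f; funext p
        rcases p with _ | ⟨m, _ | _⟩ <;> rfl
      right_inv := by intro w; rfl }
  exact Fintype.sum_equiv E _ _ (fun f => rfl)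

section
variable {ι : Type*} [Fintype ι] [DecidableEq ι] (l : ℕ) (b : ι → ℝ) (a : ι → ι → ℝ)

def FF (f : Pos l → ι) : ℝ := b (f none) * ∏ m, a (f (some (m, false))) (f (some (m, true)))

def ind (ε : Bool) (z x y : ι) : ℝ := if (cond ε y x) = z then 1 else 0

lemma ind_sum (hs : ∀ x y, a x y = a y x) (ε : Bool) (z : ι) :
    ∑ x, ∑ y, a x y * ind ε z x y = ∑ y, a z y := by
  cases ε
  · simp only [ind, cond_false]
    rw [sum_comm]
    simp
  · simp only [ind, cond_true]
    simp [hs z]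

lemma A0 (hs : ∀ x y, a x y = a y x) (m : Fin l) (ε : Bool) :
    ∑ f : Pos l → ι, FF l b a f * (if f none = f (some (m, ε)) then 1 else 0) =
      (∑ x, b x * ∑ y, a x y) * (∑ x, ∑ y, a x y) ^ (l - 1) := by
  have h1 : ∀ f : Pos l → ι, FF l b a f * (if f none = f (some (m, ε)) then 1 else 0) =
      ∑ z, (b (f none) * (if f none = z then 1 else 0)) *
        ∏ m', (a (f (some (m', false))) (f (some (m', true))) *
          if m' = m then ind ε z (f (some (m', false))) (f (some (m', true))) else 1) := by
    intro f
    simp only [prod_mul_distrib, prod_ite_eq', mem_univ, if_true, FF]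
    rw [Fintype.sum_eq_single (f none)]
    · cases ε <;> simp [ind, eq_comm]
    · intro x hx; simp [hx.symm]
  simp only [h1]
  rw [sum_comm, sum_mul]
  refine sum_congr rfl fun z _ => ?_
  rw [factor l (fun x => b x * if x = z then 1 else 0)
    (fun m' x y => a x y * if m' = m then ind ε z x y else 1)]
  rw [← mul_prod_erase univ _ (mem_univ m)]
  rw [prod_congr rfl (g := fun _ => ∑ x, ∑ y, a x y)]
  · rw [prod_const, card_erase_of_mem (mem_univ _), card_univ, Fintype.card_fin]
    simp [ind_sum a hs, mul_assoc]
  · intro x hx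
    simp [(mem_erase.1 hx).1]

lemma A1 (hs : ∀ x y, a x y = a y x) (m n : Fin l) (hmn : m ≠ n) (ε δ : Bool) :
    ∑ f : Pos l → ι, FF l b a f * (if f (some (m, ε)) = f (some (n, δ)) then 1 else 0) =
      (∑ x, b x) * (∑ x, (∑ y, a x y) ^ 2) * (∑ x, ∑ y, a x y) ^ (l - 2) := by
  have h1 : ∀ f : Pos l → ι,
      FF l b a f * (if f (some (m, ε)) = f (some (n, δ)) then 1 else 0) =
      ∑ z, b (f none) *
        ∏ m', (a (f (some (m', false))) (f (some (m', true))) *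
          (if m' = m then ind ε z (f (some (m', false))) (f (some (m', true))) else 1) *
          (if m' = n then ind δ z (f (some (m', false))) (f (some (m', true))) else 1)) := by
    intro f
    simp only [prod_mul_distrib, prod_ite_eq', mem_univ, if_true, FF]
    rw [Fintype.sum_eq_single (f (some (m, ε)))]
    · cases ε <;> cases δ <;> simp [ind] <;> grind
    · intro x hx; cases ε <;> simp [ind, hx.symm]
  simp only [h1]
  rw [sum_comm, mul_assoc, sum_mul (univ : Finset ι) (fun x => (∑ y, a x y) ^ 2), mul_sum]
  refine sum_congr rfl fun z _ => ?_
  rw [factor l b (fun m' x y => a x y * (if m' = m then ind ε z x y else 1) *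
    (if m' = n then ind δ z x y else 1))]
  rw [← mul_prod_erase univ _ (mem_univ m),
    ← mul_prod_erase (univ.erase m) _ (mem_erase.2 ⟨hmn.symm, mem_univ n⟩)]
  rw [prod_congr rfl (g := fun _ => ∑ x, ∑ y, a x y)]
  · rw [prod_const, card_erase_of_mem (mem_erase.2 ⟨hmn.symm, mem_univ n⟩),
      card_erase_of_mem (mem_univ _), card_univ, Fintype.card_fin]
    simp [ind_sum a hs, hmn, hmn.symm, Nat.sub_sub]
    ring_nf; simp
  · intro x hx
    simp only [mem_erase] at hx
    simp [hx.1, hx.2.1]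

lemma A2 (ha : ∀ x, a x x = 0) (m : Fin l) (ε : Bool) :
    ∑ f : Pos l → ι, FF l b a f * (if f (some (m, ε)) = f (some (m, !ε)) then 1 else 0) = 0 := by
  apply sum_eq_zero
  intro f _
  by_cases h : f (some (m, ε)) = f (some (m, !ε))
  · have : FF l b a f = 0 := by
      unfold FF
      rw [prod_eq_zero (mem_univ m), mul_zero]
      cases ε
      · simp at h; rw [h, ha]
      · simp at h; rw [h, ha]
    rw [this, zero_mul]
  · simp [h]

lemma total : ∑ f : Pos l → ι, FF l b a f = (∑ x, b x) * (∑ x, ∑ y, a x y) ^ l := by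
  unfold FF
  rw [factor l b (fun _ => a)]; simp

lemma pairs (hs : ∀ x y, a x y = a y x) (ha : ∀ x, a x x = 0) :
    (∑ p : Pos l, ∑ q : Pos l, if p ≠ q then
      ∑ f : Pos l → ι, FF l b a f * (if f p = f q then 1 else 0) else 0) =
    4 * l * ((∑ x, b x * ∑ y, a x y) * (∑ x, ∑ y, a x y) ^ (l - 1)) +
    4 * (l * (l - 1)) *
      ((∑ x, b x) * (∑ x, (∑ y, a x y) ^ 2) * (∑ x, ∑ y, a x y) ^ (l - 2)) := by
  set X := (∑ x, b x * ∑ y, a x y) * (∑ x, ∑ y, a x y) ^ (l - 1) with hX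
  set Y := (∑ x, b x) * (∑ x, (∑ y, a x y) ^ 2) * (∑ x, ∑ y, a x y) ^ (l - 2) with hY
  set G : Pos l → Pos l → ℝ := fun p q => if p ≠ q then
      ∑ f : Pos l → ι, FF l b a f * (if f p = f q then 1 else 0) else 0 with hG
  change ∑ p, ∑ q, G p q = _
  have g00 : G none none = 0 := by simp [hG]
  have g0 : ∀ w, G none (some w) = X := by
    intro w
    simp only [hG, ne_eq, reduceCtorEq, not_false_eq_true, if_true]
    exact A0 l b a hs w.1 w.2
  have g1 : ∀ w, G (some w) none = X := by
    intro w
    rw [← g0 w]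
    simp only [hG, ne_eq, reduceCtorEq, not_false_eq_true, if_true, eq_comm]
  have g2 : ∀ m n ε δ, G (some (m, ε)) (some (n, δ)) = if m = n then 0 else Y := by
    intro m n ε δ
    by_cases h : m = n
    · subst h
      rw [if_pos rfl]
      by_cases h : ε = δ
      · simp [hG, h]
      · have : δ = !ε := by cases ε <;> cases δ <;> simp_all
        subst this
        simp only [hG]
        rw [A2 l b a ha]; simp
    · rw [if_neg h]
      simp only [hG]
      rw [A1 l b a hs m n h, if_pos]
      simp [h]
  simp only [Fintype.sum_option, g00, g0, g1, Fintype.sum_prod_type, Fintype.sum_bool, g2]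
  have e : ∀ m : Fin l, ∑ n : Fin l, (if m = n then 0 else Y) = (l - 1) * Y := by
    intro m
    have : ∀ n : Fin l, (if m = n then 0 else Y) = Y - if m = n then Y else 0 := by
      intro n; split_ifs <;> ring
    simp only [this, sum_sub_distrib, sum_const, card_univ, Fintype.card_fin, sum_ite_eq, mem_univ,
      if_true, nsmul_eq_mul]
    ring
  simp only [sum_add_distrib, e]
  simp
  ring


lemma core (k : ℕ) (hk : Fintype.card ι ≤ k) (hs : ∀ x y, a x y = a y x) (ha : ∀ x, a x x = 0)
    (hb1 : ∀ x, |b x| ≤ 1) (ha1 : ∀ x y, |a x y| ≤ 1)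
    [DecidablePred (Function.Injective : (Pos l → ι) → Prop)] :
    |∑ f : Pos l → ι with Function.Injective f, FF l b a f - (∑ x, b x) * (∑ x, ∑ y, a x y) ^ l
      + 2 * l * ((∑ x, b x * ∑ y, a x y) * (∑ x, ∑ y, a x y) ^ (l - 1)) +
    2 * (l * (l - 1)) *
      ((∑ x, b x) * (∑ x, (∑ y, a x y) ^ 2) * (∑ x, ∑ y, a x y) ^ (l - 2))| ≤
    (((2 * l + 1 : ℝ) ^ 2 + 2) * (2 * l + 1) ^ 4) * k ^ (2 * l - 1) := by
  have hF : ∀ f, |FF l b a f| ≤ 1 := by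
    intro f
    unfold FF
    rw [abs_mul, abs_prod]
    exact mul_le_one₀ (hb1 _) (prod_nonneg fun _ _ => abs_nonneg _)
      (prod_le_one (fun _ _ => abs_nonneg _) fun _ _ => ha1 _ _)
  have h := main_est (FF l b a) hF
  rw [pairs l b a hs ha, total] at h
  have hc : Fintype.card (Pos l) = 2 * l + 1 := by simp; ring
  rw [hc] at h
  have h2 : 2 * l + 1 - 2 = 2 * l - 1 := by omega
  rw [h2] at h
  have h3 : ((Fintype.card ι : ℝ)) ^ (2 * l - 1) ≤ (k : ℝ) ^ (2 * l - 1) := by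
    gcongr
  push_cast at h
  have h4 : ((2 * l + 1 : ℝ) ^ 2 + 2) * ((2 * l + 1) ^ 4 * (Fintype.card ι : ℝ) ^ (2 * l - 1)) ≤
    (((2 * l + 1 : ℝ) ^ 2 + 2) * (2 * l + 1) ^ 4) * k ^ (2 * l - 1) := by
    rw [mul_assoc]; gcongr
  have h5 := h.trans h4
  rw [abs_le] at h5 ⊢
  have h6 : 0 ≤ (((2 * l + 1 : ℝ) ^ 2 + 2) * (2 * l + 1) ^ 4) * (k : ℝ) ^ (2 * l - 1) := by
    positivity
  constructor <;> nlinarith [h5.1, h5.2]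

end

/-- splitting a symmetric double sum -/
lemma sym_split (k : ℕ) (h : ℕ → ℕ → ℝ) (hs : ∀ i j, h i j = h j i) :
    ∑ i ∈ Icc 2 k, ∑ j ∈ Icc 2 k, h i j =
      2 * (∑ i ∈ Icc 2 k, ∑ j ∈ Icc (i + 1) k, h i j) + ∑ i ∈ Icc 2 k, h i i := by
  have e1 : ∑ i ∈ Icc 2 k, ∑ j ∈ Icc (i + 1) k, h i j =
      ∑ i ∈ Icc 2 k, ∑ j ∈ Icc 2 k, if i < j then h i j else 0 := by
    refine sum_congr rfl fun i hi => ?_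
    rw [← sum_filter]
    refine sum_congr ?_ fun _ _ => rfl
    ext j
    simp only [mem_Icc, mem_filter] at hi ⊢
    omega
  have e2 : ∑ i ∈ Icc 2 k, ∑ j ∈ Icc (i + 1) k, h i j =
      ∑ i ∈ Icc 2 k, ∑ j ∈ Icc 2 k, if j < i then h i j else 0 := by
    rw [e1, sum_comm]
    refine sum_congr rfl fun i hi => sum_congr rfl fun j hj => ?_
    rw [hs]
  have e3 : ∑ i ∈ Icc 2 k, h i i =
      ∑ i ∈ Icc 2 k, ∑ j ∈ Icc 2 k, if i = j then h i j else 0 := by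
    refine sum_congr rfl fun i hi => ?_
    rw [sum_ite_eq, if_pos hi]
  rw [two_mul]
  nth_rw 1 [e1]
  rw [e2, e3, ← sum_add_distrib, ← sum_add_distrib]
  refine sum_congr rfl fun i _ => ?_
  rw [← sum_add_distrib, ← sum_add_distrib]
  refine sum_congr rfl fun j _ => ?_
  rcases lt_trichotomy i j with h | h | h
  · simp [h, h.ne, h.not_gt]
  · simp [h]
  · simp [h, h.ne', h.not_gt]

def posFun (l : ℕ) : Pos l → Fin (2 * l + 1)
  | none => 0
  | some (m, false) => ⟨2 * m + 1, by omega⟩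
  | some (m, true) => ⟨2 * m + 2, by omega⟩

lemma posFun_bij (l : ℕ) : Function.Bijective (posFun l) := by
  rw [Fintype.bijective_iff_injective_and_card]
  constructor
  · intro p q h
    rcases p with _ | ⟨m, _ | _⟩ <;> rcases q with _ | ⟨n, _ | _⟩ <;>
      simp [posFun, Fin.ext_iff] at h ⊢ <;> omega
  · simp; ring

lemma sum_transfer (l k : ℕ) (b : ℕ → ℝ) (c : ℕ → ℕ → ℝ)
    (q1 : ∀ m : {x // x ∈ Finset.range l}, 2 * (m : ℕ) + 1 < 2 * l + 1)
    (q2 : ∀ m : {x // x ∈ Finset.range l}, 2 * (m : ℕ) + 2 < 2 * l + 1)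
    [DecidablePred (Function.Injective : (Fin (2 * l + 1) → ℕ) → Prop)]
    [DecidablePred (Function.Injective : (Pos l → Icc 2 k) → Prop)] :
    ∑ f ∈ (Fintype.piFinset fun _ : Fin (2 * l + 1) => Finset.Icc 2 k).filter
              (fun f => Function.Injective f),
            b (f 0) * ∏ m ∈ (Finset.range l).attach,
              c (f ⟨2 * (m : ℕ) + 1, q1 m⟩)
                (f ⟨2 * (m : ℕ) + 2, q2 m⟩) =
    ∑ f : Pos l → Icc 2 k with Function.Injective f,
      FF l (fun i : Icc 2 k => b i) (fun i j : Icc 2 k => if (i : ℕ) = j then 0 else c i j) f := by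
  let e := Equiv.ofBijective _ (posFun_bij l)
  symm
  refine sum_bij (fun f _ => fun x => ((f (e.symm x) : Icc 2 k) : ℕ)) ?_ ?_ ?_ ?_
  · intro f hf
    simp only [mem_filter, mem_univ, true_and, Fintype.mem_piFinset] at hf ⊢
    exact ⟨fun x => (f (e.symm x)).2,
      (Subtype.val_injective.comp hf).comp e.symm.injective⟩
  · intro f _ g _ h
    funext p
    have := congrFun h (e p)
    apply Subtype.ext
    simpa using this
  · intro g hg
    simp only [mem_filter, Fintype.mem_piFinset] at hg
    refine ⟨fun p => ⟨g (e p), hg.1 _⟩, ?_, ?_⟩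
    · simp only [mem_filter, mem_univ, true_and]
      intro p q h
      simp only [Subtype.mk.injEq] at h
      exact e.injective (hg.2 h)
    · funext x; simp
  · intro f hf
    simp only [mem_filter, mem_univ, true_and] at hf
    have e0 : e.symm 0 = none := by rw [Equiv.symm_apply_eq]; rfl
    have e1 : ∀ (m : ℕ) (h : m < l) (h' : 2 * m + 1 < 2 * l + 1),
        e.symm ⟨2 * m + 1, h'⟩ = some (⟨m, h⟩, false) := by
      intro m h h'; rw [Equiv.symm_apply_eq]; rfl
    have e2 : ∀ (m : ℕ) (h : m < l) (h' : 2 * m + 2 < 2 * l + 1),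
        e.symm ⟨2 * m + 2, h'⟩ = some (⟨m, h⟩, true) := by
      intro m h h'; rw [Equiv.symm_apply_eq]; rfl
    unfold FF
    beta_reduce
    rw [e0]
    congr 1
    symm
    refine prod_bij (fun m _ => (⟨m.1, mem_range.1 m.2⟩ : Fin l)) (by simp) ?_ ?_ ?_
    · intro x _ y _ h
      apply Subtype.ext
      simpa using h
    · intro m _
      exact ⟨⟨m.1, mem_range.2 m.2⟩, by simp, rfl⟩
    · intro m _
      rw [e1 m.1 (mem_range.1 m.2), e2 m.1 (mem_range.1 m.2), if_neg]
      intro h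
      have := hf (Subtype.ext h)
      simp at this

lemma final (l : ℕ) (hl : 1 ≤ l) (k : ℕ) (D B M T₁ T₂ R S C : ℝ)
    (hS : S = ((l.factorial : ℝ) * 2 ^ l)⁻¹ * D) (hB : |B| ≤ k) (hM : |2 * M| ≤ (k : ℝ) ^ 2)
    (hR : |R| ≤ (k : ℝ) ^ 2)
    (h : |D - B * (2 * M) ^ l + 2 * l * (T₁ * (2 * M) ^ (l - 1)) +
      2 * (l * (l - 1)) * (B * (2 * T₂ + R) * (2 * M) ^ (l - 2))| ≤ C * (k : ℝ) ^ (2 * l - 1)) :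
    |(l.factorial : ℝ) * S - B * M ^ l + l * T₁ * M ^ (l - 1) +
            l * (l - 1) * B * T₂ * M ^ (l - 2)| ≤ (C + 2 * l ^ 2) * k ^ (2 * l - 1) := by
  have hf : (l.factorial : ℝ) ≠ 0 := by positivity
  have hS' : (l.factorial : ℝ) * S = (2 ^ l)⁻¹ * D := by
    rw [hS]; field_simp
  rw [hS']
  set X := (2 ^ l : ℝ)⁻¹ * D - B * M ^ l + l * T₁ * M ^ (l - 1) +
            l * (l - 1) * B * T₂ * M ^ (l - 2) with hX
  have h2 : (1 : ℝ) ≤ 2 ^ l := one_le_pow₀ (by norm_num)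
  have key : 2 ^ l * X = (D - B * (2 * M) ^ l + 2 * l * (T₁ * (2 * M) ^ (l - 1)) +
      2 * (l * (l - 1)) * (B * (2 * T₂ + R) * (2 * M) ^ (l - 2))) -
      2 * (l * (l - 1)) * (B * R * (2 * M) ^ (l - 2)) := by
    have h3 : (2 : ℝ) ^ l * ((2 ^ l)⁻¹ * D) = D := by field_simp
    rw [hX, mul_add, mul_add, mul_sub, h3]
    rcases l with _ | _ | n
    · omega
    · simp; ring
    · simp only [mul_pow, show n + 1 + 1 - 1 = n + 1 by omega,
        show n + 1 + 1 - 2 = n by omega]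
      push_cast
      ring
  have hE : |2 * (l * (l - 1)) * (B * R * (2 * M) ^ (l - 2))| ≤ 2 * (l : ℝ) ^ 2 * k ^ (2 * l - 1) := by
    rcases l with _ | _ | n
    · omega
    · simp
    · simp only [show n + 1 + 1 - 2 = n by omega, show 2 * (n + 1 + 1) - 1 = 1 + 2 + 2 * n by omega]
      rw [abs_mul, abs_mul (B * R), abs_mul B, abs_pow, pow_add, pow_add, pow_one, pow_mul]
      have h5 : |(2 : ℝ) * (((n + 1 + 1 : ℕ) : ℝ) * (((n + 1 + 1 : ℕ) : ℝ) - 1))| ≤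
          2 * ((n + 1 + 1 : ℕ) : ℝ) ^ 2 := by
        push_cast
        rw [abs_le]
        have : (0 : ℝ) ≤ n := by positivity
        constructor <;> nlinarith
      gcongr
  have h7 : |X| ≤ |2 ^ l * X| := by
    rw [abs_mul, abs_of_nonneg (by positivity : (0 : ℝ) ≤ 2 ^ l)]
    nlinarith [abs_nonneg X]
  refine h7.trans ?_
  rw [key]
  refine (abs_sub _ _).trans ?_
  linarith

end S17



/-- Fix `l ≥ 1`. There is `C > 0` (depending only on `l`) such that for every
`k ≥ 2` and all biases `b_i ∈ [−1,1]` (`2 ≤ i ≤ k`) and symmetric pairwise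
biases `c i j ∈ [−1,1]` (`i ≠ j` in `{2,…,k}`), one has
`|l!·S₁ − β·M^l + l·T₁·M^{l−1} + l(l−1)·β·T₂·M^{l−2}| ≤ C·k^{2l−1}`, where
`β = Σ_{i=2}^k b_i`, `M = Σ_{2≤i<j≤k} c_{ij}`,
`T₁ = Σ_{(i,j) ordered, distinct} b_i c_{ij}`,
`T₂ = Σ_{i; {j,j'} ⊆ {2..k}∖{i}} c_{ij} c_{ij'}`, and `S₁` sums
`b_{j₀}·∏_{m=1}^l c_{j_m j_m'}` over all choices of `2l+1` distinct indices in
`{2,…,k}` partitioned into a singleton `{j₀}` and `l` unordered pairs, each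
partitioned set counted exactly once (here realized as a sum over injective
tuples divided by the symmetry factor `l!·2^l`). For `l = 1` the last term
`l(l−1)·β·T₂·M^{l−2}` vanishes since its coefficient `l(l−1)` is `0`. -/
theorem stmt_17 (l : ℕ) (hl : 1 ≤ l) :
    ∃ C : ℝ, 0 < C ∧ ∀ k : ℕ, 2 ≤ k → ∀ b : ℕ → ℝ, ∀ c : ℕ → ℕ → ℝ,
      (∀ i ∈ Finset.Icc 2 k, b i ∈ Set.Icc (-1 : ℝ) 1) →
      (∀ i j, c i j = c j i) →
      (∀ i ∈ Finset.Icc 2 k, ∀ j ∈ Finset.Icc 2 k, i ≠ j → c i j ∈ Set.Icc (-1 : ℝ) 1) →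
      ∀ β M T₁ T₂ S₁ : ℝ,
        β = ∑ i ∈ Finset.Icc 2 k, b i →
        M = ∑ i ∈ Finset.Icc 2 k, ∑ j ∈ Finset.Icc (i + 1) k, c i j →
        T₁ = ∑ i ∈ Finset.Icc 2 k, ∑ j ∈ (Finset.Icc 2 k).erase i, b i * c i j →
        T₂ = ∑ i ∈ Finset.Icc 2 k, ∑ j ∈ (Finset.Icc 2 k).erase i,
               ∑ j' ∈ (Finset.Icc (j + 1) k).erase i, c i j * c i j' →
        S₁ = ((l.factorial : ℝ) * 2 ^ l)⁻¹ *
          ∑ f ∈ (Fintype.piFinset fun _ : Fin (2 * l + 1) => Finset.Icc 2 k).filter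
              (fun f => Function.Injective f),
            b (f 0) * ∏ m ∈ (Finset.range l).attach,
              c (f ⟨2 * (m : ℕ) + 1, by have := Finset.mem_range.mp m.2; omega⟩)
                (f ⟨2 * (m : ℕ) + 2, by have := Finset.mem_range.mp m.2; omega⟩) →
        |(l.factorial : ℝ) * S₁ - β * M ^ l + l * T₁ * M ^ (l - 1) +
            l * (l - 1) * β * T₂ * M ^ (l - 2)| ≤ C * k ^ (2 * l - 1) := by
  classical
  refine ⟨((2 * l + 1 : ℝ) ^ 2 + 2) * (2 * l + 1) ^ 4 + 2 * l ^ 2, by positivity, ?_⟩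
  intro k hk b c hb hcs hc β M T₁ T₂ S₁ hβ hM hT₁ hT₂ hS
  rw [S17.sum_transfer l k b c (fun m => by have := Finset.mem_range.mp m.2; omega)
    (fun m => by have := Finset.mem_range.mp m.2; omega)] at hS
  set a : ℕ → ℕ → ℝ := fun i j => if i = j then 0 else c i j with ha
  have hcard : Fintype.card (Finset.Icc 2 k) ≤ k := by
    rw [Fintype.card_coe, Nat.card_Icc]; omega
  have has : ∀ i j, a i j = a j i := by
    intro i j; simp only [ha, eq_comm (a := i), hcs i j]
  have ha1 : ∀ i ∈ Finset.Icc 2 k, ∀ j ∈ Finset.Icc 2 k, |a i j| ≤ 1 := by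
    intro i hi j hj
    by_cases h : i = j
    · simp [ha, h]
    · simp only [ha, if_neg h]
      exact abs_le.2 (hc i hi j hj h)
  have hb1 : ∀ i ∈ Finset.Icc 2 k, |b i| ≤ 1 := fun i hi => abs_le.2 (hb i hi)
  have hcore := S17.core l (fun i : Finset.Icc 2 k => b i) (fun i j : Finset.Icc 2 k => a i j) k
    hcard (fun x y => has x y) (fun x => by simp [ha]) (fun x => hb1 x x.2)
    (fun x y => ha1 x x.2 y y.2)
  have hN : ((Finset.Icc 2 k).card : ℝ) ≤ k := by
    rw [Nat.card_Icc]; exact_mod_cast (by omega)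
  have s1 : ∀ g : ℕ → ℝ, ∑ x : Finset.Icc 2 k, g x = ∑ i ∈ Finset.Icc 2 k, g i :=
    fun g => Finset.sum_coe_sort _ g
  have eβ : ∑ x : Finset.Icc 2 k, b x = β := by rw [s1 b, hβ]
  have ed : ∀ i : ℕ, ∑ y : Finset.Icc 2 k, a i y = ∑ j ∈ Finset.Icc 2 k, a i j :=
    fun i => s1 (a i)
  have eM : ∑ x : Finset.Icc 2 k, ∑ y : Finset.Icc 2 k, a x y = 2 * M := by
    simp only [ed]
    rw [s1 (fun i => ∑ j ∈ Finset.Icc 2 k, a i j), S17.sym_split k a has, hM]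
    have : ∑ i ∈ Finset.Icc 2 k, a i i = 0 := by simp [ha]
    rw [this, add_zero]
    congr 1
    refine Finset.sum_congr rfl fun i _ => Finset.sum_congr rfl fun j hj => ?_
    simp only [Finset.mem_Icc] at hj
    simp only [ha]
    rw [if_neg (by omega)]
  have eT₁ : ∑ x : Finset.Icc 2 k, b x * ∑ y : Finset.Icc 2 k, a x y = T₁ := by
    simp only [ed]
    rw [s1 (fun i => b i * ∑ j ∈ Finset.Icc 2 k, a i j), hT₁]
    refine Finset.sum_congr rfl fun i hi => ?_
    rw [Finset.mul_sum, ← Finset.sum_erase _ (a := i) (by simp [ha])]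
    refine Finset.sum_congr rfl fun j hj => ?_
    simp only [ha]
    rw [if_neg (Finset.ne_of_mem_erase hj).symm]
  have eT₂ : ∑ x : Finset.Icc 2 k, (∑ y : Finset.Icc 2 k, a x y) ^ 2 =
      2 * T₂ + ∑ i ∈ Finset.Icc 2 k, ∑ j ∈ Finset.Icc 2 k, a i j * a i j := by
    simp only [ed]
    rw [s1 (fun i => (∑ j ∈ Finset.Icc 2 k, a i j) ^ 2), hT₂, Finset.mul_sum,
      ← Finset.sum_add_distrib]
    refine Finset.sum_congr rfl fun i hi => ?_
    rw [pow_two, Finset.sum_mul_sum,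
      S17.sym_split k (fun j j' => a i j * a i j') (fun _ _ => mul_comm _ _)]
    congr 2
    rw [← Finset.sum_erase _ (a := i) (by simp [ha])]
    refine Finset.sum_congr rfl fun j hj => ?_
    rw [← Finset.sum_erase _ (a := i) (by simp [ha])]
    refine Finset.sum_congr rfl fun j' hj' => ?_
    simp only [ha]
    rw [if_neg (Finset.ne_of_mem_erase hj).symm, if_neg (Finset.ne_of_mem_erase hj').symm]
  rw [eβ, eM, eT₁, eT₂] at hcore
  have dbl : ∀ g : ℕ → ℕ → ℝ, (∀ i ∈ Finset.Icc 2 k, ∀ j ∈ Finset.Icc 2 k, |g i j| ≤ 1) →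
      |∑ i ∈ Finset.Icc 2 k, ∑ j ∈ Finset.Icc 2 k, g i j| ≤ (k : ℝ) ^ 2 := by
    intro g hg
    calc _ ≤ ∑ i ∈ Finset.Icc 2 k, ∑ j ∈ Finset.Icc 2 k, |g i j| :=
          (Finset.abs_sum_le_sum_abs _ _).trans
            (Finset.sum_le_sum fun i _ => Finset.abs_sum_le_sum_abs _ _)
      _ ≤ ∑ i ∈ Finset.Icc 2 k, ∑ j ∈ Finset.Icc 2 k, (1 : ℝ) :=
          Finset.sum_le_sum fun i hi => Finset.sum_le_sum fun j hj => hg i hi j hj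
      _ = ((Finset.Icc 2 k).card : ℝ) ^ 2 := by
          simp only [Finset.sum_const, nsmul_eq_mul, mul_one, pow_two]
      _ ≤ _ := by gcongr
  refine S17.final l hl k _ β M T₁ T₂ _ S₁ _ hS ?_ ?_ ?_ hcore
  · rw [hβ]
    calc _ ≤ ∑ i ∈ Finset.Icc 2 k, |b i| := Finset.abs_sum_le_sum_abs _ _
      _ ≤ ∑ i ∈ Finset.Icc 2 k, (1 : ℝ) := Finset.sum_le_sum hb1
      _ ≤ k := by simpa only [Finset.sum_const, nsmul_eq_mul, mul_one] using hN
  · rw [← eM]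
    simp only [ed]
    rw [s1 (fun i => ∑ j ∈ Finset.Icc 2 k, a i j)]
    exact dbl a ha1
  · refine dbl (fun i j => a i j * a i j) fun i hi j hj => ?_
    rw [abs_mul]
    exact mul_le_one₀ (ha1 i hi j hj) (abs_nonneg _) (ha1 i hi j hj)
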